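/- arXiv:solv-int/9707012 — 2 statements merged into one kernel-verified Lean document; each statement's English description precedes it below -/
import Mathlib

section
/- Let w₁, w₂ : ℝ → ℝ be smooth and set v₂ = -(w₁ + w₂), v₁ = w₁w₂ - w₁'. Then for every smooth b : ℝ → ℝ, feeding the pair (0, b) through the composite J ∘ P_w ∘ J† gives exactly the second column of the reduced second Poisson tensor P̂: namely the first component of J(P_w(J†(0, b))) equals 3·(b' - v₂·b)' and the second component equals 2b''' + v₁·b' + (v₁·b)' + 2v₂·b'' - 2(v₂·b)'' - 2v₂·(v₂·b)'. -/
/-- Fréchet derivative `J` of the Miura map (fields ordered `(v₂, v₁)`, `(w₂, w₁)`):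
`J(a₂, a₁) = (-(a₂ + a₁), w₁·a₂ + w₂·a₁ - a₁')`. -/
noncomputable def miuraJ (w₁ w₂ : ℝ → ℝ) (a : (ℝ → ℝ) × (ℝ → ℝ)) : (ℝ → ℝ) × (ℝ → ℝ) :=
  (fun x => -(a.1 x + a.2 x),
   fun x => w₁ x * a.1 x + w₂ x * a.2 x - deriv a.2 x)

/-- Formal adjoint `J†` of `J` with respect to the pairing `∫ f g dx`:
`J†(b₂, b₁) = (-b₂ + w₁·b₁, -b₂ + w₂·b₁ + b₁')`. -/
noncomputable def miuraJdag (w₁ w₂ : ℝ → ℝ) (b : (ℝ → ℝ) × (ℝ → ℝ)) : (ℝ → ℝ) × (ℝ → ℝ) :=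
  (fun x => -b.1 x + w₁ x * b.2 x,
   fun x => -b.1 x + w₂ x * b.2 x + deriv b.2 x)

/-- The modified constant-coefficient Poisson tensor `P_w = -[[2∂, ∂],[∂, 2∂]]`. -/
noncomputable def modPw (p : (ℝ → ℝ) × (ℝ → ℝ)) : (ℝ → ℝ) × (ℝ → ℝ) :=
  (fun x => -(2 * deriv p.1 x + deriv p.2 x),
   fun x => -(deriv p.1 x + 2 * deriv p.2 x))

/-- The derivative of a smooth function is smooth. -/
theorem contDiff_top_deriv {f : ℝ → ℝ} (hf : ContDiff ℝ (⊤ : ℕ∞) f) :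
    ContDiff ℝ (⊤ : ℕ∞) (deriv f) :=
  (contDiff_infty_iff_deriv.mp hf).2

/-- **Second column of the reduced second Poisson tensor via the Miura map.**
For smooth `w₁ w₂` with `v₂ = -(w₁ + w₂)`, `v₁ = w₁w₂ - w₁'`,
feeding `(0, b)` through `J ∘ P_w ∘ J†` gives the second column of `P̂`:
first component `3(b' - v₂ b)'`, second component
`2b''' + v₁ b' + (v₁ b)' + 2v₂ b'' - 2(v₂ b)'' - 2v₂ (v₂ b)'`. -/
theorem miura_second_column_n3
    (w₁ w₂ : ℝ → ℝ) (hw₁ : ContDiff ℝ (⊤ : ℕ∞) w₁) (hw₂ : ContDiff ℝ (⊤ : ℕ∞) w₂)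
    (v₂ v₁ : ℝ → ℝ)
    (hv₂ : v₂ = fun x => -(w₁ x + w₂ x))
    (hv₁ : v₁ = fun x => w₁ x * w₂ x - deriv w₁ x) :
    ∀ b : ℝ → ℝ, ContDiff ℝ (⊤ : ℕ∞) b → ∀ x : ℝ,
      (miuraJ w₁ w₂ (modPw (miuraJdag w₁ w₂ ((fun _ => 0), b)))).1 x
          = 3 * deriv (fun y => deriv b y - v₂ y * b y) x
      ∧ (miuraJ w₁ w₂ (modPw (miuraJdag w₁ w₂ ((fun _ => 0), b)))).2 x
          = 2 * deriv (deriv (deriv b)) x + v₁ x * deriv b x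
            + deriv (fun y => v₁ y * b y) x + 2 * v₂ x * deriv (deriv b) x
            - 2 * deriv (deriv (fun y => v₂ y * b y)) x
            - 2 * v₂ x * deriv (fun y => v₂ y * b y) x := by
  intro b hb x
  subst hv₂ hv₁
  have smooth_differentiable {f : ℝ → ℝ} (hf : ContDiff ℝ (⊤ : ℕ∞) f) : Differentiable ℝ f :=
    hf.differentiable (by simp)
  have dw₁ := smooth_differentiable hw₁
  have dw₂ := smooth_differentiable hw₂
  have db := smooth_differentiable hb
  have dw₁' := smooth_differentiable (contDiff_top_deriv hw₁)
  have dw₂' := smooth_differentiable (contDiff_top_deriv hw₂)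
  have db' := smooth_differentiable (contDiff_top_deriv hb)
  have db'' := smooth_differentiable (contDiff_top_deriv (contDiff_top_deriv hb))
  have deriv_w₁b : deriv (fun y => w₁ y * b y) = fun y => deriv w₁ y * b y + w₁ y * deriv b y :=
    funext fun y => deriv_fun_mul (dw₁ y) (db y)
  have deriv_w₂b : deriv (fun y => w₂ y * b y + deriv b y) =
      fun y => deriv w₂ y * b y + w₂ y * deriv b y + deriv (deriv b) y := by
    funext y
    rw [deriv_fun_add (by fun_prop) (by fun_prop), deriv_fun_mul (dw₂ y) (db y)]
  have deriv_v₂b : deriv (fun y => -(w₁ y + w₂ y) * b y) =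
      fun y => -(deriv w₁ y + deriv w₂ y) * b y + -(w₁ y + w₂ y) * deriv b y :=
    funext fun y =>
      (((dw₁ y).hasDerivAt.fun_add (dw₂ y).hasDerivAt).fun_neg.fun_mul (db y).hasDerivAt).deriv
  have hW₁ := (dw₁ x).hasDerivAt
  have hW₂ := (dw₂ x).hasDerivAt
  have hB := (db x).hasDerivAt
  have hW₁' := (dw₁' x).hasDerivAt
  have hW₂' := (dw₂' x).hasDerivAt
  have hB' := (db' x).hasDerivAt
  have hB'' := (db'' x).hasDerivAt
  have hV₂ := (hW₁.fun_add hW₂).fun_neg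
  simp only [miuraJ, modPw, miuraJdag, neg_zero, zero_add, deriv_w₁b, deriv_w₂b, deriv_v₂b]
  constructor
  · rw [(hB'.fun_sub (hV₂.fun_mul hB)).deriv]
    ring
  · rw [(((hW₁'.fun_mul hB).fun_add (hW₁.fun_mul hB')).fun_add
        ((((hW₂'.fun_mul hB).fun_add (hW₂.fun_mul hB')).fun_add hB'').const_mul 2)).fun_neg.deriv,
      (((hW₁.fun_mul hW₂).fun_sub hW₁').fun_mul hB).deriv,
      (((hW₁'.fun_add hW₂').fun_neg.fun_mul hB).fun_add (hV₂.fun_mul hB')).deriv]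
    ring
end

section
/- Let w₁, w₂ : ℝ → ℝ be smooth and set v₂ = -(w₁ + w₂), v₁ = w₁w₂ - w₁'. Then for all smooth b₂, b₁ : ℝ → ℝ one has the full operator identity J(P_w(J†(b₂, b₁))) = P̂(b₂, b₁), i.e. the reduced second Poisson tensor P̂ of the n = 3 reduced constrained MKP hierarchy is the transform of the constant-coefficient modified Poisson tensor P_w under the Miura map: P̂ = J ∘ P_w ∘ J†. Componentwise: the first component of J(P_w(J†(b₂, b₁))) equals -6b₂' + 3(b₁' - v₂b₁)' and the second component equals -3(b₂'' + v₂b₂') + 2b₁''' + v₁b₁' + (v₁b₁)' + 2v₂b₁'' - 2(v₂b₁)'' - 2v₂(v₂b₁)'. -/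
/-- **Generalized Kupershmidt–Wilson theorem, n = 3 reduced cMKP example.**
With `v₂ = -(w₁ + w₂)`, `v₁ = w₁w₂ - w₁'`, the reduced second Poisson tensor `P̂`
is the Miura transform of the constant-coefficient tensor: `P̂ = J ∘ P_w ∘ J†`.
Componentwise, for all smooth `b₂ b₁`:
first component `-6b₂' + 3(b₁' - v₂b₁)'`, second component
`-3(b₂'' + v₂b₂') + 2b₁''' + v₁b₁' + (v₁b₁)' + 2v₂b₁'' - 2(v₂b₁)'' - 2v₂(v₂b₁)'`. -/
theorem miura_transforms_poisson_tensor_n3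
    (w₁ w₂ : ℝ → ℝ) (hw₁ : ContDiff ℝ (⊤ : ℕ∞) w₁) (hw₂ : ContDiff ℝ (⊤ : ℕ∞) w₂)
    (v₂ v₁ : ℝ → ℝ)
    (hv₂ : v₂ = fun x => -(w₁ x + w₂ x))
    (hv₁ : v₁ = fun x => w₁ x * w₂ x - deriv w₁ x) :
    ∀ b₂ b₁ : ℝ → ℝ, ContDiff ℝ (⊤ : ℕ∞) b₂ → ContDiff ℝ (⊤ : ℕ∞) b₁ → ∀ x : ℝ,
      (miuraJ w₁ w₂ (modPw (miuraJdag w₁ w₂ (b₂, b₁)))).1 x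
          = -6 * deriv b₂ x + 3 * deriv (fun y => deriv b₁ y - v₂ y * b₁ y) x
      ∧ (miuraJ w₁ w₂ (modPw (miuraJdag w₁ w₂ (b₂, b₁)))).2 x
          = -3 * (deriv (deriv b₂) x + v₂ x * deriv b₂ x)
            + 2 * deriv (deriv (deriv b₁)) x + v₁ x * deriv b₁ x
            + deriv (fun y => v₁ y * b₁ y) x + 2 * v₂ x * deriv (deriv b₁) x
            - 2 * deriv (deriv (fun y => v₂ y * b₁ y)) x
            - 2 * v₂ x * deriv (fun y => v₂ y * b₁ y) x := by
  subst hv₂ hv₁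
  intro b₂ b₁ hb₂ hb₁ x
  have smooth_deriv {f : ℝ → ℝ} (hf : ContDiff ℝ (⊤ : ℕ∞) f) :
      ContDiff ℝ (⊤ : ℕ∞) (deriv f) := (contDiff_infty_iff_deriv.1 hf).2
  have diff {f : ℝ → ℝ} (hf : ContDiff ℝ (⊤ : ℕ∞) f) : Differentiable ℝ f :=
    (contDiff_infty_iff_deriv.1 hf).1
  have dw₁ := diff hw₁
  have dw₁' := diff (smooth_deriv hw₁)
  have dw₂ := diff hw₂
  have dw₂' := diff (smooth_deriv hw₂)
  have db₂ := diff hb₂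
  have db₂' := diff (smooth_deriv hb₂)
  have db₁ := diff hb₁
  have db₁' := diff (smooth_deriv hb₁)
  have db₁'' := diff (smooth_deriv (smooth_deriv hb₁))
  have hp : deriv (fun y => -b₂ y + w₁ y * b₁ y) =
      fun y => -deriv b₂ y + (deriv w₁ y * b₁ y + w₁ y * deriv b₁ y) := by
    funext y
    exact ((db₂ y).hasDerivAt.neg.add ((dw₁ y).hasDerivAt.mul (db₁ y).hasDerivAt)).deriv
  have hq : deriv (fun y => -b₂ y + w₂ y * b₁ y + deriv b₁ y) =
      fun y => -deriv b₂ y + (deriv w₂ y * b₁ y + w₂ y * deriv b₁ y) + deriv (deriv b₁) y := by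
    funext y
    exact (((db₂ y).hasDerivAt.neg.add ((dw₂ y).hasDerivAt.mul (db₁ y).hasDerivAt)).add
      (db₁' y).hasDerivAt).deriv
  have hv₂b : deriv (fun y => -(w₁ y + w₂ y) * b₁ y) =
      fun y => -(deriv w₁ y + deriv w₂ y) * b₁ y + -(w₁ y + w₂ y) * deriv b₁ y := by
    funext y
    exact (((dw₁ y).hasDerivAt.add (dw₂ y).hasDerivAt).neg.mul (db₁ y).hasDerivAt).deriv
  have hv₁b : deriv (fun y => (w₁ y * w₂ y - deriv w₁ y) * b₁ y) x =
      (deriv w₁ x * w₂ x + w₁ x * deriv w₂ x - deriv (deriv w₁) x) * b₁ x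
        + (w₁ x * w₂ x - deriv w₁ x) * deriv b₁ x :=
    ((((dw₁ x).hasDerivAt.mul (dw₂ x).hasDerivAt).sub (dw₁' x).hasDerivAt).mul
      (db₁ x).hasDerivAt).deriv
  have hb₁v₂b : deriv (fun y => deriv b₁ y - -(w₁ y + w₂ y) * b₁ y) x =
      deriv (deriv b₁) x
        - (-(deriv w₁ x + deriv w₂ x) * b₁ x + -(w₁ x + w₂ x) * deriv b₁ x) :=
    ((db₁' x).hasDerivAt.sub
      (((dw₁ x).hasDerivAt.add (dw₂ x).hasDerivAt).neg.mul (db₁ x).hasDerivAt)).deriv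
  have HB₁ := (db₁ x).hasDerivAt
  have HB₁' := (db₁' x).hasDerivAt
  have HW₁ := (dw₁ x).hasDerivAt
  have HW₂ := (dw₂ x).hasDerivAt
  have HW₁' := (dw₁' x).hasDerivAt
  have HW₂' := (dw₂' x).hasDerivAt
  have hp' := (db₂' x).hasDerivAt.neg.add ((HW₁'.mul HB₁).add (HW₁.mul HB₁'))
  have hq' := ((db₂' x).hasDerivAt.neg.add ((HW₂'.mul HB₁).add (HW₂.mul HB₁'))).add
    (db₁'' x).hasDerivAt
  have hP := (hp'.add (hq'.const_mul 2)).neg.deriv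
  have hV := (((HW₁'.add HW₂').neg.mul HB₁).add ((HW₁.add HW₂).neg.mul HB₁')).deriv
  simp only [miuraJ, modPw, miuraJdag, hp, hq, hv₂b, hv₁b, hb₁v₂b]
  refine ⟨by ring, ?_⟩
  erw [hP, hV]
  simp only [Pi.add_apply, Pi.neg_apply]
  ring
end
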